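/- Let n ≥ 4 and let {p, q} be a smallest string attractor of the period-doubling word D_n with D_n[p] = a and D_n[q] = b (positions 1-based). Then p and q are both even, and {p/2, q/2} is a smallest string attractor of D_{n-1}. -/

import Mathlib

/-- The period-doubling morphism over {a, b} (with `false` = a, `true` = b):
φ(a) = ab, φ(b) = aa. -/
def phi : Bool → List Bool
  | false => [false, true]
  | true => [false, false]

/-- Period-doubling words: D 0 = a, D (n+1) = φ(D n); |D n| = 2^n. -/
def D : ℕ → List Bool
  | 0 => [false]
  | n + 1 => (D n).flatMap phi

/-- `w` occurs in `T` at (1-based) position `i`, i.e. `w = T[i .. i + |w| - 1]`. -/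
def OccursAt {α : Type*} (T w : List α) (i : ℕ) : Prop :=
  1 ≤ i ∧ i + w.length ≤ T.length + 1 ∧ (T.drop (i - 1)).take w.length = w

/-- `Γ` is a string attractor of `T`: a set of (1-based) positions of `T` such that
every nonempty substring of `T` has an occurrence crossing a position of `Γ`. -/
def IsAttractor {α : Type*} (T : List α) (Γ : Finset ℕ) : Prop :=
  (∀ k ∈ Γ, 1 ≤ k ∧ k ≤ T.length) ∧
  ∀ w : List α, w ≠ [] → w <:+: T →
    ∃ i, OccursAt T w i ∧ ∃ k ∈ Γ, i ≤ k ∧ k < i + w.length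

/-- `Γ` is a smallest string attractor of `T`. -/
def IsSmallestAttractor {α : Type*} (T : List α) (Γ : Finset ℕ) : Prop :=
  IsAttractor T Γ ∧ ∀ Γ' : Finset ℕ, IsAttractor T Γ' → Γ.card ≤ Γ'.card

/-- The set of all smallest string attractors of `T`. -/
def Att {α : Type*} (T : List α) : Set (Finset ℕ) := {Γ | IsSmallestAttractor T Γ}

lemma D_odd_get (n j : ℕ) : (D (n+1))[2*j]? = (D n)[j]?.map (fun _ => false) ∧
    (D (n+1))[2*j+1]? = (D n)[j]?.map not := by
  have key : ∀ (l : List Bool) (j : ℕ), (l.flatMap phi)[2*j]? = l[j]?.map (fun _ => false) ∧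
      (l.flatMap phi)[2*j+1]? = l[j]?.map not := by
    intro l
    induction l with
    | nil => intro j; simp
    | cons x l ih =>
      intro j
      cases j with
      | zero => cases x <;> simp [phi]
      | succ j =>
        have h := ih j
        have e : 2 * (j+1) = 2*j+1+1 := by ring
        have e' : 2 * (j+1) + 1 = 2*j+1+1+1 := by ring
        cases x <;> simpa [phi, e, e'] using h
  exact key (D n) j

lemma phi_get (l : List Bool) (j : ℕ) : (l.flatMap phi)[2*j+1]? = l[j]?.map not := by
  induction l generalizing j with
  | nil => simp
  | cons x l ih =>
    cases j with
    | zero => cases x <;> simp [phi]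
    | succ j =>
      have h := ih j
      have e' : 2 * (j+1) + 1 = 2*j+1+1+1 := by ring
      cases x <;> simpa [phi, e'] using h

lemma phi_len (l : List Bool) : (l.flatMap phi).length = 2 * l.length := by
  induction l with
  | nil => simp
  | cons x l ih => cases x <;> simp [phi, ih] <;> ring

lemma occ_get {T w : List Bool} {i : ℕ} (h : OccursAt T w i) (j : ℕ) (hj : j < w.length) :
    T[i - 1 + j]? = w[j]? := by
  obtain ⟨_, _, h3⟩ := h
  conv_rhs => rw [← h3]
  rw [List.getElem?_take_of_lt hj, List.getElem?_drop]

lemma occ_of_get {T w : List Bool} {m : ℕ} (hw : w ≠ [])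
    (h : ∀ j, j < w.length → T[m + j]? = w[j]?) :
    OccursAt T w (m+1) := by
  have hl : 0 < w.length := List.length_pos_iff.2 hw
  refine ⟨by omega, ?_, ?_⟩
  · have := h (w.length - 1) (by omega)
    rw [List.getElem?_eq_getElem (l := w) (by omega)] at this
    obtain ⟨h1, _⟩ := List.getElem?_eq_some_iff.1 this
    omega
  · apply List.ext_getElem?
    intro j
    by_cases hj : j < w.length
    · rw [List.getElem?_take_of_lt hj, List.getElem?_drop]
      simpa using h j hj
    · rw [List.getElem?_take_eq_none (by omega), List.getElem?_eq_none (by omega)]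

lemma infix_get {T w : List Bool} (h : w <:+: T) :
    ∃ m, ∀ j, j < w.length → T[m + j]? = w[j]? := by
  obtain ⟨s, t, rfl⟩ := h
  refine ⟨s.length, fun j hj => ?_⟩
  rw [List.append_assoc, List.getElem?_append_right (by omega)]
  simp [List.getElem?_append_left hj]

lemma D_true_odd {n k : ℕ} (h : (D (n+1))[k]? = some true) : k % 2 = 1 := by
  rcases Nat.even_or_odd' k with ⟨c, rfl | rfl⟩
  · rw [(D_odd_get n c).1] at h
    simp at h
  · omega

lemma no_bb {n k : ℕ} (h1 : (D (n+1))[k]? = some true) (h2 : (D (n+1))[k+1]? = some true) :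
    False := by
  have := D_true_odd h1
  have := D_true_odd h2
  omega

lemma D_prefix (n : ℕ) : D n <+: D (n+1) := by
  induction n with
  | zero => decide
  | succ n ih =>
    obtain ⟨t, ht⟩ := ih
    refine ⟨t.flatMap phi, ?_⟩
    change (D n).flatMap phi ++ _ = (D (n+1)).flatMap phi
    rw [← ht, List.flatMap_append]

lemma D_prefix_four {n : ℕ} (hn : 4 ≤ n) : D 4 <+: D n := by
  induction n, hn using Nat.le_induction with
  | base => exact List.prefix_refl _
  | succ n _ ih => exact ih.trans (D_prefix n)

lemma phi_infix {n : ℕ} {w : List Bool} (h : w <:+: D n) : w.flatMap phi <:+: D (n+1) := by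
  obtain ⟨s, t, h⟩ := h
  refine ⟨s.flatMap phi, t.flatMap phi, ?_⟩
  change _ = (D n).flatMap phi
  rw [← h]; simp

/-- Halving, given that both positions are even. -/
lemma halve_attractor (n r s : ℕ) (h : IsAttractor (D (n+2)) {2*r, 2*s})
    (hr : (D (n+1))[r-1]? = some true) :
    IsAttractor (D (n+1)) {r, s} := by
  have hlen : (D (n+2)).length = 2 * (D (n+1)).length := phi_len _
  obtain ⟨h1, h2⟩ := h
  have hr1 := h1 (2*r) (by simp)
  have hs1 := h1 (2*s) (by simp)
  refine ⟨?_, ?_⟩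
  · intro k hk
    simp only [Finset.mem_insert, Finset.mem_singleton] at hk
    rcases hk with rfl | rfl <;> omega
  · intro w hw hinf
    by_cases hf : false ∈ w
    · obtain ⟨j, hj, hjf⟩ := List.mem_iff_getElem.1 hf
      have hjf' : w[j]? = some false := by rw [List.getElem?_eq_getElem hj, hjf]
      have hne : w.flatMap phi ≠ [] := by
        intro h0
        have := phi_len w
        rw [h0] at this
        rw [List.length_nil] at this; omega
      obtain ⟨i, hi, k, hk, hik, hki⟩ := h2 _ hne (phi_infix hinf)
      rw [phi_len] at hki
      have hg := occ_get hi (2*j+1) (by rw [phi_len]; omega)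
      rw [phi_get, hjf'] at hg
      have hodd := D_true_odd (n := n+1) hg
      have hi1 := hi.1
      obtain ⟨m, rfl⟩ : ∃ m, i = 2*m+1 := ⟨(i-1)/2, by omega⟩
      refine ⟨m+1, occ_of_get hw ?_, ?_⟩
      · intro l hl
        have hg := occ_get hi (2*l+1) (by rw [phi_len]; omega)
        rw [phi_get] at hg
        have e : 2*m+1-1+(2*l+1) = 2*(m+l)+1 := by omega
        rw [e, (D_odd_get (n+1) (m+l)).2] at hg
        exact Option.map_injective (fun a b => by cases a <;> cases b <;> simp) hg
      · simp only [Finset.mem_insert, Finset.mem_singleton] at hk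
        rcases hk with rfl | rfl
        · exact ⟨r, by simp, by omega, by omega⟩
        · exact ⟨s, by simp, by omega, by omega⟩
    · match w, hw with
      | [true], _ =>
        refine ⟨r - 1 + 1, occ_of_get (by simp) ?_, r, by simp, by omega, by simp; omega⟩
        intro j hj
        have : j = 0 := by simpa using hj
        subst this
        simpa using hr
      | false :: _, _ => simp at hf
      | true :: false :: _, _ => simp at hf
      | true :: true :: w, _ =>
        obtain ⟨m, hm⟩ := infix_get hinf
        exact (no_bb (hm 0 (by simp)) (hm 1 (by simp))).elim

/-- Letters by 1-based integer position. -/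
def letter (T : List Bool) (z : ℤ) : Option Bool := if z ≤ 0 then none else T[z.toNat - 1]?

lemma letter_nat (T : List Bool) (k : ℕ) (hk : 1 ≤ k) : letter T k = T[k-1]? := by
  unfold letter
  rw [if_neg (by omega)]
  simp

lemma letter_true {n : ℕ} {z : ℤ} (h : letter (D (n+1)) z = some true) : z % 2 = 0 := by
  unfold letter at h
  split_ifs at h with hz
  have := D_true_odd h
  omega

lemma letter_no {n : ℕ} {z : ℤ} (hz : z % 2 = 0) (h : letter (D (n+2)) z = some false)
    (h' : letter (D (n+2)) (z+2) = some false) : False := by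
  unfold letter at h h'
  split_ifs at h h' with h1 h2
  obtain ⟨k, rfl⟩ : ∃ k : ℕ, z = 2*k+2 := ⟨(z/2 - 1).toNat, by omega⟩
  rw [show (2*(k:ℤ)+2).toNat - 1 = 2*k+1 by omega, (D_odd_get _ _).2] at h
  rw [show (2*(k:ℤ)+2+2).toNat - 1 = 2*(k+1)+1 by omega, (D_odd_get _ _).2] at h'
  simp only [Option.map_eq_some_iff, Bool.not_eq_false, exists_eq_right] at h h'
  simp at h h'
  exact no_bb h h'

lemma cross {T : List Bool} {p q : ℕ} (h : IsAttractor T {p, q}) (w : List Bool) (hw : w ≠ [])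
    (hinf : w <:+: T) :
    ∃ i : ℤ, (∀ j : ℕ, j < w.length → letter T (i + j) = w[j]?) ∧
      ((i ≤ p ∧ p < i + w.length) ∨ (i ≤ q ∧ q < i + w.length)) := by
  obtain ⟨i, hi, k, hk, h1, h2⟩ := h.2 w hw hinf
  refine ⟨i, ?_, ?_⟩
  · intro j hj
    have := hi.1
    rw [← occ_get hi j hj, ← Nat.cast_add, letter_nat _ _ (by omega)]
    congr 1
    omega
  · simp only [Finset.mem_insert, Finset.mem_singleton] at hk
    rcases hk with rfl | rfl
    · left; omega
    · right; omega

lemma cross3 {n p q : ℕ} (h : IsAttractor (D (n+1)) {p, q}) (hp : p % 2 = 1) (hq : q % 2 = 0)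
    (x y : Bool) (hxy : x = true ∨ y = true) (hinf : [x, false, y] <:+: D (n+1)) :
    (letter (D (n+1)) (p-1) = some x ∧ letter (D (n+1)) (p+1) = some y) ∨
    (letter (D (n+1)) (q-2) = some x ∧ letter (D (n+1)) q = some y) ∨
    (letter (D (n+1)) q = some x ∧ letter (D (n+1)) (q+2) = some y) := by
  obtain ⟨i, hi, hc⟩ := cross h _ (by simp) hinf
  have g0 := hi 0 (by simp)
  have g2 := hi 2 (by simp)
  simp at g0 g2 hc
  have hev : i % 2 = 0 := by
    rcases hxy with rfl | rfl
    · exact letter_true g0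
    · have := letter_true g2; omega
  have : i = p - 1 ∨ i = q - 2 ∨ i = q := by omega
  rcases this with rfl | rfl | rfl
  · left; ring_nf at *; tauto
  · right; left; ring_nf at *; tauto
  · right; right; ring_nf at *; tauto

lemma cross5 {n p q : ℕ} (h : IsAttractor (D (n+1)) {p, q}) (hp : p % 2 = 1) (hq : q % 2 = 0)
    (x y z : Bool) (hxy : x = true ∨ y = true ∨ z = true)
    (hinf : [x, false, y, false, z] <:+: D (n+1)) :
    (letter (D (n+1)) (p-3) = some x ∧ letter (D (n+1)) (p-1) = some y ∧
      letter (D (n+1)) (p+1) = some z) ∨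
    (letter (D (n+1)) (p-1) = some x ∧ letter (D (n+1)) (p+1) = some y ∧
      letter (D (n+1)) (p+3) = some z) ∨
    (letter (D (n+1)) (q-4) = some x ∧ letter (D (n+1)) (q-2) = some y ∧
      letter (D (n+1)) q = some z) ∨
    (letter (D (n+1)) (q-2) = some x ∧ letter (D (n+1)) q = some y ∧
      letter (D (n+1)) (q+2) = some z) ∨
    (letter (D (n+1)) q = some x ∧ letter (D (n+1)) (q+2) = some y ∧
      letter (D (n+1)) (q+4) = some z) := by
  obtain ⟨i, hi, hc⟩ := cross h _ (by simp) hinf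
  have g0 := hi 0 (by simp)
  have g2 := hi 2 (by simp)
  have g4 := hi 4 (by simp)
  simp at g0 g2 g4 hc
  have hev : i % 2 = 0 := by
    rcases hxy with rfl | rfl | rfl
    · exact letter_true g0
    · have := letter_true g2; omega
    · have := letter_true g4; omega
  have : i = p - 3 ∨ i = p - 1 ∨ i = q - 4 ∨ i = q - 2 ∨ i = q := by omega
  rcases this with rfl | rfl | rfl | rfl | rfl
  · left; ring_nf at *; tauto
  · right; left; ring_nf at *; tauto
  · right; right; left; ring_nf at *; tauto
  · right; right; right; left; ring_nf at *; tauto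
  · right; right; right; right; ring_nf at *; tauto

lemma p_even {n p q : ℕ} (hn : 4 ≤ n + 2) (h : IsAttractor (D (n+2)) {p, q}) (hq : q % 2 = 0)
    (hqb : (D (n+2))[q-1]? = some true) : p % 2 = 0 := by
  by_contra hp
  have hp : p % 2 = 1 := by omega
  have hq1 := (h.1 q (by simp)).1
  have hp1 := (h.1 p (by simp)).1
  have hi : ∀ w : List Bool, w <:+: D 4 → w <:+: D (n+2) :=
    fun w hw => hw.trans (D_prefix_four hn).isInfix
  have lq : letter (D (n+2)) q = some true := by rw [letter_nat _ _ hq1, hqb]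
  have a1 := cross3 h hp hq true false (by simp) (hi _ (by decide))
  have a2 := cross3 h hp hq false true (by simp) (hi _ (by decide))
  have a3 := cross3 h hp hq true true (by simp) (hi _ (by decide))
  have b1 := cross5 h hp hq true false true (by simp) (hi _ (by decide))
  have b2 := cross5 h hp hq true true true (by simp) (hi _ (by decide))
  have b3 := cross5 h hp hq true true false (by simp) (hi _ (by decide))
  have b4 := cross5 h hp hq false true true (by simp) (hi _ (by decide))
  have b5 := cross5 h hp hq false true false (by simp) (hi _ (by decide))
  have c1 := @letter_no n (q-4) (by omega)
  have c2 := @letter_no n (q+2) (by omega)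
  have c3 := @letter_no n (p-3) (by omega)
  have c4 := @letter_no n (p-1) (by omega)
  have c5 := @letter_no n (p+1) (by omega)
  rw [show (q:ℤ)-4+2 = q-2 by ring] at c1
  rw [show (q:ℤ)+2+2 = q+4 by ring] at c2
  rw [show (p:ℤ)-3+2 = p-1 by ring] at c3
  rw [show (p:ℤ)-1+2 = p+1 by ring] at c4
  rw [show (p:ℤ)+1+2 = p+3 by ring] at c5
  rw [lq] at a1 a2 a3 b1 b2 b3 b4 b5
  clear h hi hqb lq
  generalize letter (D (n+2)) (q-4) = x1 at *
  generalize letter (D (n+2)) (q-2) = x2 at *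
  generalize letter (D (n+2)) (q+2) = x3 at *
  generalize letter (D (n+2)) (q+4) = x4 at *
  generalize letter (D (n+2)) (p-3) = y1 at *
  generalize letter (D (n+2)) (p-1) = y2 at *
  generalize letter (D (n+2)) (p+1) = y3 at *
  generalize letter (D (n+2)) (p+3) = y4 at *
  grind

/-- Let n ≥ 4 and {p, q} be a smallest string attractor of D_n with
D_n[p] = a and D_n[q] = b (1-based). Then p, q are even and {p/2, q/2} is a smallest
string attractor of D_{n-1}. -/
theorem pd_attractor_halving :
    ∀ n : ℕ, 4 ≤ n → ∀ p q : ℕ,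
      IsSmallestAttractor (D n) ({p, q} : Finset ℕ) →
      (D n)[p - 1]? = some false →
      (D n)[q - 1]? = some true →
      2 ∣ p ∧ 2 ∣ q ∧ IsSmallestAttractor (D (n - 1)) ({p / 2, q / 2} : Finset ℕ) := by
  intro N hN p q hsm hpa hqb
  obtain ⟨n, rfl⟩ : ∃ n, N = n + 2 := ⟨N - 2, by omega⟩
  obtain ⟨hatt, -⟩ := hsm
  have hp1 := (hatt.1 p (by simp)).1
  have hq1 := (hatt.1 q (by simp)).1
  have hq : q % 2 = 0 := by
    have := D_true_odd (n := n+1) hqb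
    omega
  have hp : p % 2 = 0 := p_even hN hatt hq hqb
  obtain ⟨r, rfl⟩ : ∃ r, p = 2 * r := ⟨p / 2, by omega⟩
  obtain ⟨s, rfl⟩ : ∃ s, q = 2 * s := ⟨q / 2, by omega⟩
  refine ⟨⟨r, rfl⟩, ⟨s, rfl⟩, ?_⟩
  rw [Nat.mul_div_cancel_left r (by norm_num), Nat.mul_div_cancel_left s (by norm_num)]
  change IsSmallestAttractor (D (n+1)) {r, s}
  have hr : (D (n+1))[r-1]? = some true := by
    rw [show 2 * r - 1 = 2 * (r-1) + 1 by omega, (D_odd_get (n+1) (r-1)).2] at hpa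
    simpa using hpa
  have hs : (D (n+1))[s-1]? = some false := by
    rw [show 2 * s - 1 = 2 * (s-1) + 1 by omega, (D_odd_get (n+1) (s-1)).2] at hqb
    simpa using hqb
  refine ⟨halve_attractor n r s hatt hr, ?_⟩
  intro Γ hΓ
  have get : ∀ (x : Bool) (k : ℕ), (D (n+1))[k]? = some x → ∃ m ∈ Γ, (D (n+1))[m-1]? = some x := by
    intro x k hk
    have hinf : [x] <:+: D (n+1) := by
      rw [List.singleton_infix_iff]
      exact List.mem_of_getElem? hk
    obtain ⟨i, hi, m, hm, h1, h2⟩ := hΓ.2 [x] (by simp) hinf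
    have hg := occ_get hi 0 (by simp)
    have : m = i := by simp at h2; omega
    subst this
    exact ⟨m, hm, by simpa using hg⟩
  obtain ⟨a, ha, ha'⟩ := get _ _ hr
  obtain ⟨b, hb, hb'⟩ := get _ _ hs
  have hab : a ≠ b := by
    rintro rfl
    rw [ha'] at hb'
    simp at hb'
  exact Finset.card_le_two.trans (Finset.one_lt_card.2 ⟨a, ha, b, hb, hab⟩)
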